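/- Let ψ : ℕ → ℝ be any function tending to infinity. Then the set of natural numbers n satisfying (1/log 3 − 1/log 4)·log n − ψ(n)·√(log n) ≤ s_3(n) − s_2(n) ≤ (1/log 3 − 1/log 4)·log n + ψ(n)·√(log n) has asymptotic natural density 1; that is, the number of n ≤ N in this set, divided by N, tends to 1 as N → ∞. -/

import Mathlib

open Filter Finset

/-- `digitSum b n` is the sum of the digits of `n` in base `b`. -/
def digitSum (b n : ℕ) : ℕ := (Nat.digits b n).sum

theorem digitSum_add_mul {b : ℕ} (hb : 2 ≤ b) {r : ℕ} (hr : r < b) (m : ℕ) :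
    digitSum b (r + b * m) = r + digitSum b m := by
  unfold digitSum
  by_cases h : r = 0 ∧ m = 0
  · simp [h.1, h.2]
  · rw [Nat.digits_add b (by omega) r m hr (by tauto), List.sum_cons]

theorem sum_range_mul_eq_sum_sum (f : ℕ → ℝ) (b m : ℕ) :
    ∑ n ∈ range (m * b), f n = ∑ i ∈ range m, ∑ r ∈ range b, f (r + b * i) := by
  induction m with
  | zero => simp
  | succ m ih =>
    rw [Nat.succ_mul, Finset.sum_range_add, ih, Finset.sum_range_succ]
    congr 1
    refine Finset.sum_congr rfl fun r _ => ?_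
    congr 1
    ring

theorem sum_range_natCast_add_sq (y : ℝ) (m : ℕ) :
    ∑ r ∈ range m, ((r : ℝ) + y) ^ 2 =
      m * y ^ 2 + m * (m - 1) * y + m * (m - 1) * (2 * m - 1) / 6 := by
  induction m with
  | zero => simp
  | succ m ih =>
    rw [Finset.sum_range_succ, ih]
    push_cast
    ring

/-- The variance of the sum of `k` independent uniform base-`b` digits. -/
theorem sum_range_pow_digitSum_sub_sq {b : ℕ} (hb : 2 ≤ b) (k : ℕ) :
    ∑ n ∈ range (b ^ k), ((digitSum b n : ℝ) - (b - 1) / 2 * k) ^ 2 =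
      ((b : ℝ) ^ 2 - 1) / 12 * k * b ^ k := by
  induction k with
  | zero => simp [digitSum]
  | succ k ih =>
    rw [pow_succ, sum_range_mul_eq_sum_sum]
    have h : ∀ i ∈ range (b ^ k), ∑ r ∈ range b,
        ((digitSum b (r + b * i) : ℝ) - (b - 1) / 2 * (k + 1 : ℕ)) ^ 2 =
        b * ((digitSum b i : ℝ) - (b - 1) / 2 * k) ^ 2 + b * ((b : ℝ) ^ 2 - 1) / 12 := by
      intro i _
      rw [Finset.sum_congr rfl (g := fun r : ℕ => ((r : ℝ) +
        ((digitSum b i : ℝ) - (b - 1) / 2 * (k + 1 : ℕ))) ^ 2), sum_range_natCast_add_sq]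
      · push_cast
        ring
      · intro r hr
        rw [digitSum_add_mul hb (Finset.mem_range.1 hr)]
        push_cast
        ring
    rw [Finset.sum_congr rfl h, Finset.sum_add_distrib, ← Finset.mul_sum, ih]
    simp only [sum_const, card_range, nsmul_eq_mul]
    push_cast
    ring

theorem sum_Icc_log_sub_log_le (N : ℕ) :
    ∑ n ∈ Icc 1 N, (Real.log N - Real.log n) ≤ N := by
  rcases Nat.eq_zero_or_pos N with rfl | hN
  · simp
  have h1 : ∑ n ∈ Icc 1 N, Real.log n = Real.log (N.factorial) := by
    rw [← Real.log_prod (fun n hn => by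
      have := (Finset.mem_Icc.1 hn).1
      positivity), ← Finset.prod_Ico_id_eq_factorial, Ico_add_one_right_eq_Icc]
    push_cast
    rfl
  have h2 := Real.pow_div_factorial_le_exp (N : ℝ) (by positivity) N
  have h3 := Real.log_le_log (by positivity) h2
  rw [Real.log_exp, Real.log_div (by positivity) (by positivity), Real.log_pow] at h3
  rw [Finset.sum_sub_distrib, h1]
  simpa using h3

theorem sum_Icc_log_sub_log_sq_le (N : ℕ) :
    ∑ n ∈ Icc 1 N, (Real.log N - Real.log n) ^ 2 ≤ N * Real.log N := by
  calc ∑ n ∈ Icc 1 N, (Real.log N - Real.log n) ^ 2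
      ≤ ∑ n ∈ Icc 1 N, (Real.log N - Real.log n) * Real.log N := by
        refine Finset.sum_le_sum fun n hn => ?_
        obtain ⟨h1, h2⟩ := Finset.mem_Icc.1 hn
        have h3 : Real.log n ≤ Real.log N :=
          Real.log_le_log (by exact_mod_cast h1) (by exact_mod_cast h2)
        have h4 := Real.log_natCast_nonneg n
        rw [sq]
        exact mul_le_mul_of_nonneg_left (by linarith) (by linarith)
    _ ≤ N * Real.log N := by
        rw [← Finset.sum_mul]
        exact mul_le_mul_of_nonneg_right (sum_Icc_log_sub_log_le N) (Real.log_natCast_nonneg N)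

/-- The digit sum in base `b` deviates from `(b - 1) / (2 log b) * log n` by `O(√(log N))` in
quadratic mean over `1 ≤ n ≤ N`. -/
theorem exists_sum_Icc_digitSum_sub_log_sq_le {b : ℕ} (hb : 2 ≤ b) :
    ∃ C : ℝ, ∀ N : ℕ, 3 ≤ N →
      ∑ n ∈ Icc 1 N, ((digitSum b n : ℝ) - (b - 1) / 2 / Real.log b * Real.log n) ^ 2 ≤
        C * (N * Real.log N) := by
  have hb' : (2 : ℝ) ≤ b := by exact_mod_cast hb
  have hlb : 0 < Real.log b := Real.log_pos (by linarith)
  set c : ℝ := ((b : ℝ) - 1) / 2 with hc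
  set V : ℝ := ((b : ℝ) ^ 2 - 1) / 12 with hV
  have hV0 : 0 ≤ V := by
    have : (1 : ℝ) ≤ (b : ℝ) ^ 2 := by nlinarith
    rw [hV]
    linarith
  refine ⟨3 * (V * b * (1 / Real.log b + 1) + c ^ 2 + (c / Real.log b) ^ 2), fun N hN => ?_⟩
  have hN3 : (3 : ℝ) ≤ N := by exact_mod_cast hN
  have hlN : 1 ≤ Real.log N := by
    rw [Real.le_log_iff_exp_le (by linarith)]
    linarith [Real.exp_one_lt_d9]
  set k : ℕ := Nat.log b N + 1 with hk
  have hlow : (b : ℝ) ^ k ≤ b * N := by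
    have : b ^ Nat.log b N ≤ N := Nat.pow_log_le_self b (by omega)
    have : (b : ℝ) ^ Nat.log b N ≤ N := by exact_mod_cast this
    rw [hk, pow_succ, mul_comm]
    gcongr
  have hlog1 : (k - 1 : ℝ) * Real.log b ≤ Real.log N := by
    have := Real.log_le_log (by positivity) hlow
    rw [Real.log_pow, Real.log_mul (by positivity) (by positivity)] at this
    linarith
  have hlt : N < b ^ k := Nat.lt_pow_succ_log_self (by omega) N
  have hlog2 : Real.log N ≤ k * Real.log b := by
    rw [← Real.log_pow]
    exact Real.log_le_log (by positivity) (by exact_mod_cast hlt.le)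
  have hk1 : (k : ℝ) ≤ (1 / Real.log b + 1) * Real.log N := by
    have : (k - 1 : ℝ) ≤ Real.log N / Real.log b := (le_div_iff₀ hlb).2 hlog1
    have e : (1 / Real.log b + 1) * Real.log N = Real.log N / Real.log b + Real.log N := by ring
    linarith
  have hdev : (c * k - c / Real.log b * Real.log N) ^ 2 ≤ c ^ 2 := by
    have e : c * k - c / Real.log b * Real.log N = c * (k - Real.log N / Real.log b) := by ring
    have h1 : (k - 1 : ℝ) ≤ Real.log N / Real.log b := (le_div_iff₀ hlb).2 hlog1
    have h2 : Real.log N / Real.log b ≤ k := (div_le_iff₀ hlb).2 hlog2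
    rw [e, mul_pow]
    have h3 : (k - Real.log N / Real.log b) ^ 2 ≤ 1 := by nlinarith
    nlinarith [sq_nonneg c]
  have hmain : ∑ n ∈ Icc 1 N, ((digitSum b n : ℝ) - c * k) ^ 2 ≤
      V * b * (1 / Real.log b + 1) * (N * Real.log N) := by
    calc ∑ n ∈ Icc 1 N, ((digitSum b n : ℝ) - c * k) ^ 2
        ≤ ∑ n ∈ range (b ^ k), ((digitSum b n : ℝ) - c * k) ^ 2 := by
          refine Finset.sum_le_sum_of_subset_of_nonneg (fun n hn => ?_) fun _ _ _ => sq_nonneg _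
          exact Finset.mem_range.2 ((Finset.mem_Icc.1 hn).2.trans_lt hlt)
      _ = V * k * b ^ k := sum_range_pow_digitSum_sub_sq hb k
      _ ≤ V * ((1 / Real.log b + 1) * Real.log N) * (b * N) := by gcongr
      _ = V * b * (1 / Real.log b + 1) * (N * Real.log N) := by ring
  calc ∑ n ∈ Icc 1 N, ((digitSum b n : ℝ) - c / Real.log b * Real.log n) ^ 2
      ≤ ∑ n ∈ Icc 1 N, (3 * ((digitSum b n : ℝ) - c * k) ^ 2 + 3 * c ^ 2 +
          3 * (c / Real.log b) ^ 2 * (Real.log N - Real.log n) ^ 2) := by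
        refine Finset.sum_le_sum fun n _ => ?_
        have h : ∀ x y z : ℝ, (x + y + z) ^ 2 ≤ 3 * x ^ 2 + 3 * y ^ 2 + 3 * z ^ 2 := fun x y z => by
          nlinarith [sq_nonneg (x - y), sq_nonneg (y - z), sq_nonneg (x - z)]
        have := h ((digitSum b n : ℝ) - c * k) (c * k - c / Real.log b * Real.log N)
          (c / Real.log b * (Real.log N - Real.log n))
        rw [mul_pow (c / Real.log b)] at this
        calc _ = _ := by ring
          _ ≤ _ := this
          _ ≤ _ := by linarith
    _ = 3 * ∑ n ∈ Icc 1 N, ((digitSum b n : ℝ) - c * k) ^ 2 + 3 * c ^ 2 * N +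
          3 * (c / Real.log b) ^ 2 * ∑ n ∈ Icc 1 N, (Real.log N - Real.log n) ^ 2 := by
        simp only [sum_add_distrib, ← Finset.mul_sum, sum_const, Nat.card_Icc, nsmul_eq_mul,
          Nat.add_sub_cancel]
        ring
    _ ≤ 3 * (V * b * (1 / Real.log b + 1) * (N * Real.log N)) + 3 * c ^ 2 * (N * Real.log N) +
          3 * (c / Real.log b) ^ 2 * (N * Real.log N) := by
        gcongr
        · nlinarith
        · exact sum_Icc_log_sub_log_sq_le N
    _ = _ := by ring

theorem exists_sum_Icc_digitSum_three_sub_two_sq_le :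
    ∃ C : ℝ, ∀ N : ℕ, 3 ≤ N →
      ∑ n ∈ Icc 1 N, ((digitSum 3 n : ℝ) - digitSum 2 n -
        (1 / Real.log 3 - 1 / Real.log 4) * Real.log n) ^ 2 ≤ C * (N * Real.log N) := by
  obtain ⟨A, hA⟩ := exists_sum_Icc_digitSum_sub_log_sq_le (b := 3) (by norm_num)
  obtain ⟨B, hB⟩ := exists_sum_Icc_digitSum_sub_log_sq_le (b := 2) (by norm_num)
  refine ⟨2 * A + 2 * B, fun N hN => ?_⟩
  have h4 : Real.log 4 = 2 * Real.log 2 := by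
    rw [show (4 : ℝ) = 2 ^ 2 by norm_num, Real.log_pow]
    norm_num
  have hA' := hA N hN
  have hB' := hB N hN
  push_cast at hA' hB'
  calc _ ≤ ∑ n ∈ Icc 1 N,
        (2 * ((digitSum 3 n : ℝ) - (3 - 1) / 2 / Real.log 3 * Real.log n) ^ 2 +
        2 * ((digitSum 2 n : ℝ) - (2 - 1) / 2 / Real.log 2 * Real.log n) ^ 2) := by
        refine Finset.sum_le_sum fun n _ => ?_
        have h : ∀ x y : ℝ, (x - y) ^ 2 ≤ 2 * x ^ 2 + 2 * y ^ 2 := fun x y => by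
          nlinarith [sq_nonneg (x + y)]
        refine le_trans (le_of_eq ?_) (h _ _)
        rw [h4]
        have : Real.log 2 ≠ 0 := (Real.log_pos (by norm_num)).ne'
        have : Real.log 3 ≠ 0 := (Real.log_pos (by norm_num)).ne'
        field_simp
        ring
    _ ≤ _ := by
        rw [Finset.sum_add_distrib, ← Finset.mul_sum, ← Finset.mul_sum]
        linarith

/-- A Chebyshev argument: a quadratic mean of order `√(log N)` forces `|D n| ≤ ψ n * √(log n)`
for almost all `n`. -/
theorem tendsto_card_filter_not_sq_le_div {D ψ : ℕ → ℝ} (hψ : Tendsto ψ atTop atTop) {C : ℝ}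
    (hC : ∀ N : ℕ, 3 ≤ N → ∑ n ∈ Icc 1 N, D n ^ 2 ≤ C * (N * Real.log N)) :
    Tendsto (fun N : ℕ =>
      (#{n ∈ Icc 1 N | ¬ |D n| ≤ ψ n * Real.sqrt (Real.log n)} : ℝ) / N) atTop (nhds 0) := by
  have hC0 : 0 ≤ C := by
    have h1 := (Finset.sum_nonneg fun n _ => sq_nonneg (D n)).trans (hC 3 le_rfl)
    have h2 : 0 < ((3 : ℕ) : ℝ) * Real.log (3 : ℕ) :=
      mul_pos (by norm_num) (Real.log_pos (by norm_num))
    exact nonneg_of_mul_nonneg_left h1 h2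
  refine tendsto_order.2 ⟨fun a ha => .of_forall fun N => ha.trans_le (by positivity),
    fun ε hε => ?_⟩
  obtain ⟨K, hK0, hK⟩ : ∃ K : ℝ, 0 < K ∧ 2 * C / K ^ 2 < ε / 2 := by
    have h : Tendsto (fun K : ℝ => 2 * C / K ^ 2) atTop (nhds 0) :=
      tendsto_const_nhds.div_atTop (tendsto_pow_atTop two_ne_zero)
    exact ((eventually_gt_atTop 0).and (h.eventually_lt_const (half_pos hε))).exists
  obtain ⟨n₀, hn₀⟩ := eventually_atTop.1 (hψ.eventually_ge_atTop K)
  have hsmall : Tendsto (fun N : ℕ => (n₀ : ℝ) / N + (Real.sqrt N)⁻¹) atTop (nhds 0) := by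
    simpa using (tendsto_const_div_atTop_nhds_zero_nat (n₀ : ℝ)).add
      (tendsto_inv_atTop_zero.comp (Real.tendsto_sqrt_atTop.comp tendsto_natCast_atTop_atTop))
  filter_upwards [hsmall.eventually_lt_const (half_pos hε), eventually_ge_atTop 3] with N h1 hN
  have hN3 : (3 : ℝ) ≤ N := by exact_mod_cast hN
  have hNpos : (0 : ℝ) < N := by linarith
  have hlN : 0 < Real.log N := Real.log_pos (by linarith)
  set S := {n ∈ Icc 1 N | ¬ |D n| ≤ ψ n * Real.sqrt (Real.log n)} with hS
  set T := {n ∈ Icc 1 N | K ^ 2 / 2 * Real.log N ≤ D n ^ 2} with hT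
  have hsub : S ⊆ range n₀ ∪ Icc 1 N.sqrt ∪ T := by
    intro n hn
    obtain ⟨hnI, hnD⟩ := Finset.mem_filter.1 hn
    obtain ⟨hn1, hnN⟩ := Finset.mem_Icc.1 hnI
    by_cases ha : n < n₀
    · simp [ha]
    by_cases hb : n ≤ N.sqrt
    · simp [hb, hn1]
    refine Finset.mem_union_right _ (Finset.mem_filter.2 ⟨hnI, ?_⟩)
    have hlog : Real.log N ≤ 2 * Real.log n := by
      have h : N ≤ n ^ 2 := (sq n ▸ Nat.sqrt_lt.1 (not_le.1 hb)).le
      have h := Real.log_le_log hNpos (show (N : ℝ) ≤ (n : ℝ) ^ 2 by exact_mod_cast h)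
      rw [Real.log_pow] at h
      exact_mod_cast h
    have hD : K * Real.sqrt (Real.log n) ≤ |D n| :=
      (mul_le_mul_of_nonneg_right (hn₀ n (not_lt.1 ha)) (Real.sqrt_nonneg _)).trans
        (not_le.1 hnD).le
    have hD2 := pow_le_pow_left₀ (by positivity) hD 2
    rw [mul_pow, Real.sq_sqrt (Real.log_natCast_nonneg n), sq_abs] at hD2
    nlinarith [mul_le_mul_of_nonneg_left hlog (sq_nonneg K)]
  have hTcard : (#T : ℝ) ≤ 2 * C / K ^ 2 * N := by
    have h2 : (#T : ℝ) * (K ^ 2 / 2 * Real.log N) ≤ C * (N * Real.log N) := by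
      calc (#T : ℝ) * (K ^ 2 / 2 * Real.log N) = ∑ n ∈ T, K ^ 2 / 2 * Real.log N := by simp
        _ ≤ ∑ n ∈ T, D n ^ 2 := Finset.sum_le_sum fun n hn => (Finset.mem_filter.1 hn).2
        _ ≤ ∑ n ∈ Icc 1 N, D n ^ 2 :=
          Finset.sum_le_sum_of_subset_of_nonneg (Finset.filter_subset _ _) fun _ _ _ => sq_nonneg _
        _ ≤ _ := hC N hN
    rw [← le_div_iff₀ (by positivity)] at h2
    refine h2.trans_eq ?_
    field_simp
  have hScard : (#S : ℝ) ≤ n₀ + Real.sqrt N + 2 * C / K ^ 2 * N := by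
    have h3 : #S ≤ n₀ + N.sqrt + #T := by
      refine (Finset.card_le_card hsub).trans ((Finset.card_union_le _ _).trans ?_)
      gcongr
      simpa using Finset.card_union_le (range n₀) (Icc 1 N.sqrt)
    have h3 : (#S : ℝ) ≤ n₀ + N.sqrt + #T := by exact_mod_cast h3
    have := Real.nat_sqrt_le_real_sqrt (a := N)
    linarith
  calc (#S : ℝ) / N ≤ (n₀ + Real.sqrt N + 2 * C / K ^ 2 * N) / N := by gcongr
    _ = (n₀ : ℝ) / N + (Real.sqrt N)⁻¹ + 2 * C / K ^ 2 := by
      rw [add_div, add_div, Real.sqrt_div_self', mul_div_cancel_right₀ _ hNpos.ne', one_div]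
    _ < ε := by linarith

/-- If `ψ → ∞`, the set of `n` with
`(1/log 3 − 1/log 4)·log n − ψ(n)·√(log n) ≤ s₃(n) − s₂(n)
  ≤ (1/log 3 − 1/log 4)·log n + ψ(n)·√(log n)` has asymptotic density `1`. -/
theorem digit_sums_difference_density_one (ψ : ℕ → ℝ) (hψ : Tendsto ψ atTop atTop) :
    Tendsto (fun N : ℕ =>
      (((Finset.Icc 1 N).filter (fun n : ℕ =>
        (1 / Real.log 3 - 1 / Real.log 4) * Real.log (n : ℝ)
            - ψ n * Real.sqrt (Real.log (n : ℝ))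
            ≤ (digitSum 3 n : ℝ) - (digitSum 2 n : ℝ) ∧
        (digitSum 3 n : ℝ) - (digitSum 2 n : ℝ)
            ≤ (1 / Real.log 3 - 1 / Real.log 4) * Real.log (n : ℝ)
              + ψ n * Real.sqrt (Real.log (n : ℝ)))).card : ℝ) / (N : ℝ))
      atTop (nhds 1) := by
  obtain ⟨C, hC⟩ := exists_sum_Icc_digitSum_three_sub_two_sq_le
  have h := (tendsto_card_filter_not_sq_le_div hψ hC).const_sub 1
  rw [sub_zero] at h
  refine h.congr' ?_
  filter_upwards [eventually_gt_atTop 0] with N hN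
  have hN : (N : ℝ) ≠ 0 := by positivity
  rw [eq_div_iff hN, sub_mul, div_mul_cancel₀ _ hN, one_mul, sub_eq_iff_eq_add]
  have hcard := Finset.card_filter_add_card_filter_not (s := Icc 1 N) (fun n : ℕ =>
    |(digitSum 3 n : ℝ) - digitSum 2 n - (1 / Real.log 3 - 1 / Real.log 4) * Real.log n| ≤
      ψ n * Real.sqrt (Real.log n))
  rw [Nat.card_Icc, Nat.add_sub_cancel] at hcard
  rw [← Nat.cast_add, Nat.cast_inj]
  refine hcard.symm.trans ?_
  congr 2
  refine Finset.filter_congr fun n _ => ?_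
  rw [abs_le]
  constructor <;> rintro ⟨h1, h2⟩ <;> constructor <;> linarith
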